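/- arXiv:2102.00049 — 6 statements merged into one kernel-verified Lean document; each statement's English description precedes it below -/
import Mathlib

section
/- For each n ≥ 1 there exists a constant C = C(n) > 0 such that the following holds. Let U ⊆ ℝⁿ be an open set and let A be a locally integrable function on U whose BMO seminorm is at most M, i.e. for every closed ball B ⊆ U, (1/|B|)∫_B |A − A_B| ≤ M where A_B = (1/|B|)∫_B A. Define Â(z) = (1/|B_z|)∫_{B_z} A, where B_z = B(z, dist(z, ∂U)/2). Then Â has BMO seminorm at most C·M on U, i.e. for every closed ball B ⊆ U, (1/|B|)∫_B |Â − (Â)_B| ≤ C·M. -/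
open MeasureTheory Set Function

noncomputable section

/-- The average of `A` over a set `s ⊆ ℝⁿ` with respect to Lebesgue measure. -/
def setAvgE {n : ℕ} (A : EuclideanSpace ℝ (Fin n) → ℝ) (s : Set (EuclideanSpace ℝ (Fin n))) :
    ℝ :=
  (∫ z in s, A z) / (volume s).toReal

/-- `Â(z)`: the average of `A` over the ball `B(z, dist(z, ∂U)/2)`. -/
def hatAvgE {n : ℕ} (U : Set (EuclideanSpace ℝ (Fin n))) (A : EuclideanSpace ℝ (Fin n) → ℝ)
    (z : EuclideanSpace ℝ (Fin n)) : ℝ :=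
  setAvgE A (Metric.closedBall z (Metric.infDist z (frontier U) / 2))

open Metric in
/-- A closed ball centred in `U` that does not reach the frontier of `U` lies in `U`. -/
lemma closedBall_subset_of_lt_infDist_frontier {E : Type*} [NormedAddCommGroup E]
    [NormedSpace ℝ E] {U : Set E} (hU : IsOpen U) {z : E} (hz : z ∈ U) {s : ℝ}
    (hs : s < infDist z (frontier U)) : closedBall z s ⊆ U := by
  rcases lt_or_ge s 0 with h0 | h0
  · simp [closedBall_eq_empty.2 h0]
  have hpre : IsPreconnected (closedBall z s) := (convex_closedBall z s).isPreconnected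
  rw [isPreconnected_iff_subset_of_disjoint] at hpre
  have hdisj : ∀ w ∈ closedBall z s, w ∉ frontier U := fun w hw hwf => by
    have h1 := infDist_le_dist_of_mem (x := z) hwf
    rw [mem_closedBall'] at hw
    linarith
  refine (hpre U (closure U)ᶜ hU isClosed_closure.isOpen_compl ?_ ?_).resolve_right ?_
  · intro w hw
    by_cases hwU : w ∈ U
    · exact Or.inl hwU
    · refine Or.inr fun hc => hdisj w hw ?_
      rw [hU.frontier_eq]
      exact ⟨hc, hwU⟩
  · refine eq_empty_of_forall_notMem fun w hw => hw.2.2 (subset_closure hw.2.1)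
  · exact fun h => h (mem_closedBall_self h0) (subset_closure hz)

open Metric in
/-- Distance to the frontier of `U` dominates distance to the boundary of a ball inside `U`. -/
lemma sub_dist_le_infDist_frontier {E : Type*} [PseudoMetricSpace E] {U : Set E}
    (hU : IsOpen U) (hne : (frontier U).Nonempty) {c : E} {r : ℝ} (hB : closedBall c r ⊆ U)
    (z : E) : r - dist z c ≤ infDist z (frontier U) := by
  rw [le_infDist hne]
  intro y hy
  rw [hU.frontier_eq] at hy
  have h1 : r < dist y c := by
    by_contra! h
    exact hy.2 (hB h)
  have := dist_triangle y z c
  rw [dist_comm y z] at this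
  linarith

lemma infDist_frontier_pos {E : Type*} [PseudoMetricSpace E] {U : Set E} (hU : IsOpen U)
    (hne : (frontier U).Nonempty) {z : E} (hz : z ∈ U) : 0 < Metric.infDist z (frontier U) := by
  refine (isClosed_frontier.notMem_iff_infDist_pos hne).1 fun h => ?_
  rw [hU.frontier_eq] at h
  exact h.2 hz

section

variable {n : ℕ}

/-- `BMO` seminorm at most `M` on `U`, together with integrability on the balls of `U`. -/
structure BMOBound (U : Set (EuclideanSpace ℝ (Fin n))) (A : EuclideanSpace ℝ (Fin n) → ℝ)
    (M : ℝ) : Prop where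
  integrableOn : ∀ (c : EuclideanSpace ℝ (Fin n)) (r : ℝ), 0 < r → Metric.closedBall c r ⊆ U →
    IntegrableOn A (Metric.closedBall c r)
  oscillation_le : ∀ (c : EuclideanSpace ℝ (Fin n)) (r : ℝ), 0 < r → Metric.closedBall c r ⊆ U →
    (∫ z in Metric.closedBall c r, |A z - setAvgE A (Metric.closedBall c r)|) /
      (volume (Metric.closedBall c r)).toReal ≤ M

lemma volume_closedBall_toReal_pos (c : EuclideanSpace ℝ (Fin n)) {r : ℝ} (hr : 0 < r) :
    0 < (volume (Metric.closedBall c r)).toReal :=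
  ENNReal.toReal_pos (Metric.measure_closedBall_pos volume c hr).ne' measure_closedBall_lt_top.ne

lemma volume_closedBall_toReal (c : EuclideanSpace ℝ (Fin n)) {r : ℝ} (hr : 0 ≤ r) :
    (volume (Metric.closedBall c r)).toReal =
      r ^ n * (volume (Metric.closedBall (0 : EuclideanSpace ℝ (Fin n)) 1)).toReal := by
  have := Measure.addHaar_real_closedBall' (volume : Measure (EuclideanSpace ℝ (Fin n))) c hr
  simpa [measureReal_def] using this

/-- The average over `s` is within the mean deviation over `s` of any constant. -/
lemma abs_setAvgE_sub_le {A : EuclideanSpace ℝ (Fin n) → ℝ} {s : Set (EuclideanSpace ℝ (Fin n))}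
    (hA : IntegrableOn A s) (hs : 0 < (volume s).toReal) (a : ℝ) :
    |setAvgE A s - a| ≤ (∫ z in s, |A z - a|) / (volume s).toReal := by
  have hfin : volume s ≠ ⊤ := fun h => by simp [h] at hs
  have h1 : setAvgE A s - a = (∫ z in s, (A z - a)) / (volume s).toReal := by
    rw [integral_sub hA (integrableOn_const hfin), setIntegral_const, setAvgE, measureReal_def,
      smul_eq_mul]
    field_simp
  rw [h1, abs_div, abs_of_pos hs]
  gcongr
  exact abs_integral_le_integral_abs

namespace BMOBound

variable {U : Set (EuclideanSpace ℝ (Fin n))} {A : EuclideanSpace ℝ (Fin n) → ℝ} {M : ℝ}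

lemma nonneg (h : BMOBound U A M) {c : EuclideanSpace ℝ (Fin n)} {r : ℝ} (hr : 0 < r)
    (hB : Metric.closedBall c r ⊆ U) : 0 ≤ M :=
  le_trans (div_nonneg (integral_nonneg fun _ => abs_nonneg _) ENNReal.toReal_nonneg)
    (h.oscillation_le c r hr hB)

/-- Averages over nested balls of comparable radii differ by at most a multiple of `M`. -/
lemma abs_setAvgE_sub_setAvgE_le (h : BMOBound U A M) {c₁ c₂ : EuclideanSpace ℝ (Fin n)}
    {r₁ r₂ q : ℝ} (hr₁ : 0 < r₁) (hr₂ : 0 < r₂)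
    (hsub : Metric.closedBall c₁ r₁ ⊆ Metric.closedBall c₂ r₂) (hB : Metric.closedBall c₂ r₂ ⊆ U)
    (hq : r₂ ≤ q * r₁) :
    |setAvgE A (Metric.closedBall c₁ r₁) - setAvgE A (Metric.closedBall c₂ r₂)| ≤ q ^ n * M := by
  have hM := h.nonneg hr₂ hB
  have hv₁ := volume_closedBall_toReal_pos c₁ hr₁
  have hv₂ := volume_closedBall_toReal_pos c₂ hr₂
  have hi := h.integrableOn c₂ r₂ hr₂ hB
  have hosc := h.oscillation_le c₂ r₂ hr₂ hB
  refine (abs_setAvgE_sub_le (hi.mono_set hsub) hv₁ _).trans ?_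
  rw [div_le_iff₀ hv₂] at hosc
  rw [div_le_iff₀ hv₁]
  set a := setAvgE A (Metric.closedBall c₂ r₂)
  have hvol : (volume (Metric.closedBall c₂ r₂)).toReal ≤
      q ^ n * (volume (Metric.closedBall c₁ r₁)).toReal := by
    rw [volume_closedBall_toReal c₁ hr₁.le, volume_closedBall_toReal c₂ hr₂.le, ← mul_assoc,
      ← mul_pow]
    gcongr
  have hint : IntegrableOn (fun z => |A z - a|) (Metric.closedBall c₂ r₂) :=
    (hi.sub (integrableOn_const measure_closedBall_lt_top.ne)).abs
  calc ∫ z in Metric.closedBall c₁ r₁, |A z - a|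
      ≤ ∫ z in Metric.closedBall c₂ r₂, |A z - a| :=
        setIntegral_mono_set hint (ae_of_all _ fun _ => abs_nonneg _) hsub.eventuallyLE
    _ ≤ M * (volume (Metric.closedBall c₂ r₂)).toReal := hosc
    _ ≤ M * (q ^ n * (volume (Metric.closedBall c₁ r₁)).toReal) := by gcongr
    _ = q ^ n * M * (volume (Metric.closedBall c₁ r₁)).toReal := by ring

/-- Comparison of a ball with its image under a dyadic contraction towards one of its points. -/
lemma abs_setAvgE_contraction_sub_le (h : BMOBound U A M) {c z : EuclideanSpace ℝ (Fin n)} {r : ℝ}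
    (hr : 0 < r) (hB : Metric.closedBall c r ⊆ U) (hz : dist z c ≤ r) (k : ℕ) :
    Metric.closedBall (z + (1 / 2 : ℝ) ^ k • (c - z)) ((1 / 2 : ℝ) ^ k * r) ⊆
        Metric.closedBall c r ∧
      |setAvgE A (Metric.closedBall (z + (1 / 2 : ℝ) ^ k • (c - z)) ((1 / 2 : ℝ) ^ k * r)) -
        setAvgE A (Metric.closedBall c r)| ≤ k * (2 ^ n * M) := by
  induction k with
  | zero => simp
  | succ k ih =>
    have hp : (0 : ℝ) < (1 / 2) ^ k := by positivity
    have hstep : Metric.closedBall (z + (1 / 2 : ℝ) ^ (k + 1) • (c - z))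
        ((1 / 2 : ℝ) ^ (k + 1) * r) ⊆
        Metric.closedBall (z + (1 / 2 : ℝ) ^ k • (c - z)) ((1 / 2 : ℝ) ^ k * r) := by
      refine Metric.closedBall_subset_closedBall' ?_
      rw [dist_add_left, dist_eq_norm, ← sub_smul, norm_smul, ← dist_eq_norm c z, dist_comm c z,
        pow_succ, Real.norm_eq_abs,
        show (1 / 2 : ℝ) ^ k * (1 / 2) - (1 / 2) ^ k = -((1 / 2) ^ k * (1 / 2)) by ring, abs_neg,
        abs_of_pos (by positivity)]
      nlinarith
    have hcmp := h.abs_setAvgE_sub_setAvgE_le (q := 2) (by positivity) (by positivity) hstep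
      (ih.1.trans hB) (by rw [pow_succ]; linarith)
    refine ⟨hstep.trans ih.1, (abs_sub_le _ _ _).trans ((add_le_add hcmp ih.2).trans ?_)⟩
    push_cast
    linarith

/-- Logarithmic growth of `Â` towards the boundary: `Â(z)` differs from the average over a ball
`B ∋ z` by at most the number of dyadic scales between `dist(z, ∂U)` and the radius of `B`. -/
lemma exists_abs_hatAvgE_sub_le (h : BMOBound U A M) (hU : IsOpen U)
    (hne : (frontier U).Nonempty) {c z : EuclideanSpace ℝ (Fin n)} {r : ℝ}
    (hr : 0 < r) (hB : Metric.closedBall c r ⊆ U) (hz : z ∈ Metric.closedBall c r)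
    (hd : Metric.infDist z (frontier U) ≤ 4 * r) :
    ∃ k : ℕ, |hatAvgE U A z - setAvgE A (Metric.closedBall c r)| ≤ 4 ^ n * M * (1 + k) ∧
      ∀ j < k, r - dist z c < 4 * r * (1 / 2) ^ j := by
  classical
  set d := Metric.infDist z (frontier U) with hd_def
  have hdpos : 0 < d := infDist_frontier_pos hU hne (hB hz)
  have hM := h.nonneg hr hB
  have hex : ∃ k : ℕ, 4 * r * (1 / 2 : ℝ) ^ k ≤ d := by
    obtain ⟨k, hk⟩ := exists_pow_lt_of_lt_one (show 0 < d / (4 * r) by positivity)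
      (show (1 / 2 : ℝ) < 1 by norm_num)
    exact ⟨k, by rw [lt_div_iff₀ (by positivity)] at hk; linarith⟩
  have hmin : ∀ j < Nat.find hex, d < 4 * r * (1 / 2 : ℝ) ^ j := fun j hj =>
    not_le.1 (Nat.find_min hex hj)
  have hspec := Nat.find_spec hex
  set k := Nat.find hex
  refine ⟨k, ?_, fun j hj => (sub_dist_le_infDist_frontier hU hne hB z).trans_lt (hmin j hj)⟩
  have hp : (0 : ℝ) < (1 / 2) ^ k := by positivity
  have hlow : d ≤ 8 * r * (1 / 2 : ℝ) ^ k := by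
    rcases Nat.eq_zero_or_pos k with hk | hk
    · rw [hk]; linarith
    · have := hmin (k - 1) (by omega)
      have h2 : (1 / 2 : ℝ) ^ k = (1 / 2) ^ (k - 1) * (1 / 2) := by
        rw [← pow_succ, Nat.sub_add_cancel hk]
      rw [h2]; linarith
  have hzc : dist z c ≤ r := hz
  have hsub : Metric.closedBall (z + (1 / 2 : ℝ) ^ k • (c - z)) ((1 / 2 : ℝ) ^ k * r) ⊆
      Metric.closedBall z (d / 2) := by
    refine Metric.closedBall_subset_closedBall' ?_
    rw [dist_self_add_left, norm_smul, ← dist_eq_norm, dist_comm c z, Real.norm_eq_abs,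
      abs_of_pos hp]
    nlinarith
  have hcmp := h.abs_setAvgE_sub_setAvgE_le (q := 4) (by positivity) (by positivity) hsub
    (closedBall_subset_of_lt_infDist_frontier hU (hB hz) (by linarith)) (by linarith)
  have hchain := (h.abs_setAvgE_contraction_sub_le hr hB hzc k).2
  rw [abs_sub_comm] at hcmp
  have h24 : (k : ℝ) * (2 ^ n * M) ≤ k * (4 ^ n * M) := by gcongr; norm_num
  refine (abs_sub_le _ _ _).trans ((add_le_add hcmp hchain).trans ?_)
  linarith

/-- Far from the boundary, `Â` is comparable with a single average. -/
lemma abs_hatAvgE_sub_le_of_far (h : BMOBound U A M) (hU : IsOpen U)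
    {c z : EuclideanSpace ℝ (Fin n)} {r : ℝ}
    (hr : 0 < r) (hB : Metric.closedBall c r ⊆ U) (hz : z ∈ Metric.closedBall c r)
    (hd : 3 * r < Metric.infDist c (frontier U)) :
    |hatAvgE U A z - setAvgE A (Metric.closedBall c
      (r + 2 * Metric.infDist c (frontier U) / 3))| ≤ 4 ^ n * M := by
  have hc : c ∈ U := hB (Metric.mem_closedBall_self hr.le)
  have hzc : dist z c ≤ r := hz
  have h1 := Metric.infDist_le_infDist_add_dist (s := frontier U) (x := z) (y := c)
  have h2 := Metric.infDist_le_infDist_add_dist (s := frontier U) (x := c) (y := z)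
  rw [dist_comm c z] at h2
  refine h.abs_setAvgE_sub_setAvgE_le (by linarith) (by linarith)
    (Metric.closedBall_subset_closedBall' (by linarith))
    (closedBall_subset_of_lt_infDist_frontier hU hc (by linarith)) (by linarith)

lemma aestronglyMeasurable (h : BMOBound U A M) (hU : IsOpen U) :
    AEStronglyMeasurable A (volume.restrict U) := by
  refine LocallyIntegrableOn.aestronglyMeasurable fun x hx => ?_
  obtain ⟨r, hr, hB⟩ := Metric.nhds_basis_closedBall.mem_iff.1 (hU.mem_nhds hx)
  exact ⟨_, mem_nhdsWithin_of_mem_nhds (Metric.closedBall_mem_nhds x hr),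
    h.integrableOn x r hr hB⟩

lemma aestronglyMeasurable_hatAvgE (h : BMOBound U A M) (hU : IsOpen U)
    (hne : (frontier U).Nonempty) :
    AEStronglyMeasurable (hatAvgE U A) (volume.restrict U) := by
  have hA := h.aestronglyMeasurable hU
  set A' := hA.mk A
  have hA' : StronglyMeasurable A' := hA.stronglyMeasurable_mk
  have hcont : Continuous fun z : EuclideanSpace ℝ (Fin n) => Metric.infDist z (frontier U) / 2 :=
    (Metric.continuous_infDist_pt _).div_const 2
  have hset : MeasurableSet {p : EuclideanSpace ℝ (Fin n) × EuclideanSpace ℝ (Fin n) |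
      dist p.2 p.1 ≤ Metric.infDist p.1 (frontier U) / 2} :=
    (isClosed_le (continuous_snd.dist continuous_fst)
      (hcont.comp continuous_fst)).measurableSet
  have hnum : StronglyMeasurable fun z => ∫ w, ({p : EuclideanSpace ℝ (Fin n) ×
      EuclideanSpace ℝ (Fin n) | dist p.2 p.1 ≤ Metric.infDist p.1 (frontier U) / 2}.indicator
      (fun p => A' p.2)) (z, w) :=
    StronglyMeasurable.integral_prod_right (f := fun z w => _)
      ((hA'.comp_measurable measurable_snd).indicator hset)
  have hden : StronglyMeasurable fun z : EuclideanSpace ℝ (Fin n) =>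
      (Metric.infDist z (frontier U) / 2) ^ n *
        (volume (Metric.closedBall (0 : EuclideanSpace ℝ (Fin n)) 1)).toReal :=
    ((hcont.pow n).mul continuous_const).stronglyMeasurable
  refine ⟨_, hnum.div hden, ?_⟩
  refine (ae_restrict_iff' hU.measurableSet).2 (ae_of_all _ fun z hz => ?_)
  have hpos := infDist_frontier_pos hU hne hz
  have hsub : Metric.closedBall z (Metric.infDist z (frontier U) / 2) ⊆ U :=
    closedBall_subset_of_lt_infDist_frontier hU hz (by linarith)
  simp only [hatAvgE, setAvgE, Pi.div_apply]
  rw [volume_closedBall_toReal z (by positivity)]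
  congr 1
  rw [integral_congr_ae (ae_restrict_of_ae_restrict_of_subset hsub hA.ae_eq_mk),
    ← integral_indicator Metric.isClosed_closedBall.measurableSet]
  rfl

end BMOBound

/-- The part of a ball within `θ r` of its boundary has relative measure at most `n θ`. -/
lemma volume_closedBall_inter_annulus_le (hn : 1 ≤ n) (c : EuclideanSpace ℝ (Fin n)) {r : ℝ}
    (hr : 0 < r) {θ : ℝ} (hθ : 0 < θ) :
    volume ({z | r - dist z c < θ * r} ∩ Metric.closedBall c r) ≤
      ENNReal.ofReal (n * θ) * volume (Metric.closedBall c r) := by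
  have hn' : (1 : ℝ) ≤ n := by exact_mod_cast hn
  rcases le_or_gt 1 θ with h1 | h1
  · refine (measure_mono inter_subset_right).trans ?_
    have : (1 : ENNReal) ≤ ENNReal.ofReal (n * θ) := by
      rw [ENNReal.one_le_ofReal]; nlinarith
    exact le_mul_of_one_le_left' this
  · have hle : (1 - θ) * r ≤ r := by nlinarith
    have h0 : 0 ≤ (1 - θ) * r := by nlinarith
    have hsub : {z | r - dist z c < θ * r} ∩ Metric.closedBall c r ⊆
        Metric.closedBall c r \ Metric.closedBall c ((1 - θ) * r) := fun z hz =>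
      ⟨hz.2, fun hz' => by
        have h2 := hz.1
        simp only [mem_ofPred_eq, Metric.mem_closedBall] at h2 hz'
        linarith⟩
    refine (measure_mono hsub).trans ?_
    rw [← ENNReal.toReal_le_toReal (measure_ne_top_of_subset sdiff_subset
        measure_closedBall_lt_top.ne)
        (ENNReal.mul_ne_top ENNReal.ofReal_ne_top measure_closedBall_lt_top.ne),
      ENNReal.toReal_mul, ENNReal.toReal_ofReal (by positivity)]
    change volume.real _ ≤ _
    rw [measureReal_sdiff (Metric.closedBall_subset_closedBall hle)
      Metric.isClosed_closedBall.measurableSet measure_closedBall_lt_top.ne, measureReal_def, measureReal_def,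
      volume_closedBall_toReal c hr.le, volume_closedBall_toReal c h0, mul_pow]
    have hb := one_add_mul_le_pow (a := -θ) (by linarith) n
    have hv : 0 ≤ r ^ n * (volume (Metric.closedBall (0 : EuclideanSpace ℝ (Fin n)) 1)).toReal := by
      positivity
    rw [← sub_eq_add_neg] at hb
    nlinarith

/-- A function with logarithmic growth at the boundary of a ball has bounded mean. -/
lemma lintegral_closedBall_le_of_dyadic (hn : 1 ≤ n) (c : EuclideanSpace ℝ (Fin n)) {r K : ℝ}
    (hr : 0 < r) {f : EuclideanSpace ℝ (Fin n) → ℝ}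
    (hf : ∀ z ∈ Metric.closedBall c r, ∃ k : ℕ, |f z| ≤ K * (1 + k) ∧
      ∀ j < k, r - dist z c < 4 * r * (1 / 2) ^ j) :
    ∫⁻ z in Metric.closedBall c r, ‖f z‖ₑ ≤
      ENNReal.ofReal (K * (1 + 8 * n)) * volume (Metric.closedBall c r) := by
  have hK : 0 ≤ K := by
    obtain ⟨k, hk, -⟩ := hf c (Metric.mem_closedBall_self hr.le)
    by_contra! hneg
    have : K * (1 + k) < 0 := mul_neg_of_neg_of_pos hneg (by positivity)
    linarith [abs_nonneg (f c)]
  set S : ℕ → Set (EuclideanSpace ℝ (Fin n)) := fun j =>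
    {z | r - dist z c < (4 * (1 / 2) ^ j) * r}
  have hS : ∀ j, MeasurableSet (S j) := fun j =>
    (isOpen_lt (continuous_const.sub (continuous_id.dist continuous_const))
      continuous_const).measurableSet
  have hpt : ∀ z ∈ Metric.closedBall c r,
      ‖f z‖ₑ ≤ ENNReal.ofReal K * (1 + ∑' j, (S j).indicator 1 z) := by
    intro z hz
    obtain ⟨k, hk, hj⟩ := hf z hz
    rw [Real.enorm_eq_ofReal_abs]
    refine (ENNReal.ofReal_le_ofReal hk).trans ?_
    rw [ENNReal.ofReal_mul hK]
    gcongr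
    rw [ENNReal.ofReal_add zero_le_one (by positivity), ENNReal.ofReal_one, ENNReal.ofReal_natCast]
    gcongr
    refine le_trans (le_of_eq ?_) (ENNReal.sum_le_tsum (Finset.range k))
    rw [Finset.sum_congr rfl (g := fun _ => (1 : ENNReal))]
    · simp
    · intro j hjk
      refine indicator_of_mem ?_ _
      have := hj j (Finset.mem_range.1 hjk)
      simp only [S, mem_ofPred_eq]
      linarith
  calc ∫⁻ z in Metric.closedBall c r, ‖f z‖ₑ
      ≤ ∫⁻ z in Metric.closedBall c r, ENNReal.ofReal K * (1 + ∑' j, (S j).indicator 1 z) :=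
        setLIntegral_mono' Metric.isClosed_closedBall.measurableSet hpt
    _ = ENNReal.ofReal K * (volume (Metric.closedBall c r) +
          ∑' j, volume (S j ∩ Metric.closedBall c r)) := by
        rw [lintegral_const_mul' _ _ ENNReal.ofReal_ne_top, lintegral_add_left measurable_const,
          lintegral_tsum fun j => (measurable_one.indicator (hS j)).aemeasurable]
        simp [lintegral_indicator_one (hS _), Measure.restrict_apply (hS _)]
    _ ≤ ENNReal.ofReal K * (volume (Metric.closedBall c r) +
          ∑' j : ℕ, ENNReal.ofReal (n * (4 * (1 / 2) ^ j)) *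
            volume (Metric.closedBall c r)) := by
        gcongr with j
        exact volume_closedBall_inter_annulus_le hn c hr (by positivity)
    _ = ENNReal.ofReal (K * (1 + 8 * n)) * volume (Metric.closedBall c r) := by
        have hsum : HasSum (fun j : ℕ => (n : ℝ) * (4 * (1 / 2) ^ j)) (n * (4 * 2)) :=
          (hasSum_geometric_two.mul_left 4).mul_left _
        rw [ENNReal.tsum_mul_right, ← ENNReal.ofReal_tsum_of_nonneg (fun j => by positivity)
          hsum.summable, hsum.tsum_eq, ENNReal.ofReal_mul hK,
          ENNReal.ofReal_add zero_le_one (by positivity), ENNReal.ofReal_one,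
          show (n : ℝ) * (4 * 2) = 8 * n by ring]
        ring

/-- A mean deviation bound from some constant controls the mean oscillation. -/
lemma oscillation_le_of_lintegral_le {f : EuclideanSpace ℝ (Fin n) → ℝ}
    {s : Set (EuclideanSpace ℝ (Fin n))} (hs : 0 < (volume s).toReal)
    (hf : AEStronglyMeasurable f (volume.restrict s)) {a L : ℝ} (hL : 0 ≤ L)
    (h : ∫⁻ z in s, ‖f z - a‖ₑ ≤ ENNReal.ofReal L * volume s) :
    (∫ z in s, |f z - setAvgE f s|) / (volume s).toReal ≤ 2 * L := by
  have hfin : volume s ≠ ⊤ := fun h => by simp [h] at hs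
  have htop : ENNReal.ofReal L * volume s ≠ ⊤ := ENNReal.mul_ne_top ENNReal.ofReal_ne_top hfin
  have hm : AEStronglyMeasurable (fun z => f z - a) (volume.restrict s) :=
    hf.sub aestronglyMeasurable_const
  have hi : IntegrableOn (fun z => f z - a) s := ⟨hm, h.trans_lt htop.lt_top⟩
  have hc : ∀ b : ℝ, IntegrableOn (fun _ : EuclideanSpace ℝ (Fin n) => b) s :=
    fun b => integrableOn_const hfin
  have hfi : IntegrableOn f s := by simpa [Pi.add_def] using hi.add (hc a)
  have hdev : ∫ z in s, |f z - a| ≤ L * (volume s).toReal := by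
    have := ENNReal.toReal_mono htop h
    rw [← integral_norm_eq_lintegral_enorm hm, ENNReal.toReal_mul, ENNReal.toReal_ofReal hL] at this
    exact this
  have havg : |setAvgE f s - a| ≤ L :=
    (abs_setAvgE_sub_le hfi hs a).trans ((div_le_iff₀ hs).2 hdev)
  rw [div_le_iff₀ hs]
  calc ∫ z in s, |f z - setAvgE f s| ≤ ∫ z in s, (|f z - a| + L) := by
        refine integral_mono (hfi.sub (hc _)).abs (hi.abs.add (hc L)) fun z => ?_
        refine (abs_sub_le _ a _).trans ?_
        rw [abs_sub_comm a]
        gcongr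
    _ = (∫ z in s, |f z - a|) + L * (volume s).toReal := by
        rw [integral_add hi.abs (hc L), setIntegral_const, smul_eq_mul, measureReal_def, mul_comm L]
    _ ≤ 2 * L * (volume s).toReal := by linarith

end

/-- For each `n ≥ 1` there is `C = C(n) > 0` such that: if `U ⊆ ℝⁿ` is open
and `A` is locally integrable on `U` with BMO seminorm at most `M` (over all closed balls
contained in `U`), then `Â` has BMO seminorm at most `C·M` on `U`. -/
theorem bmo_of_hat_average (n : ℕ) (hn : 1 ≤ n) :
    ∃ C : ℝ, 0 < C ∧
      ∀ (U : Set (EuclideanSpace ℝ (Fin n))), IsOpen U →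
      ∀ (A : EuclideanSpace ℝ (Fin n) → ℝ) (M : ℝ),
        (∀ (c : EuclideanSpace ℝ (Fin n)) (r : ℝ), 0 < r → Metric.closedBall c r ⊆ U →
          IntegrableOn A (Metric.closedBall c r)) →
        (∀ (c : EuclideanSpace ℝ (Fin n)) (r : ℝ), 0 < r → Metric.closedBall c r ⊆ U →
          (∫ z in Metric.closedBall c r, |A z - setAvgE A (Metric.closedBall c r)|) /
            (volume (Metric.closedBall c r)).toReal ≤ M) →
        ∀ (c : EuclideanSpace ℝ (Fin n)) (r : ℝ), 0 < r → Metric.closedBall c r ⊆ U →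
          (∫ z in Metric.closedBall c r,
              |hatAvgE U A z - setAvgE (hatAvgE U A) (Metric.closedBall c r)|) /
            (volume (Metric.closedBall c r)).toReal ≤ C * M := by
  refine ⟨2 * (4 ^ n * (1 + 8 * n)), by positivity, fun U hU A M hint hosc c r hr hB => ?_⟩
  have h : BMOBound U A M := ⟨hint, hosc⟩
  have hM := h.nonneg hr hB
  rcases (frontier U).eq_empty_or_nonempty with hemp | hne
  · have hnt : Nonempty (Fin n) := ⟨⟨0, hn⟩⟩
    have hzero : hatAvgE U A = 0 := by
      funext z
      simp [hatAvgE, setAvgE, hemp]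
    rw [hzero]
    simp only [setAvgE, Pi.zero_apply, integral_zero, zero_div, sub_zero, abs_zero]
    positivity
  have key : ∃ a : ℝ, ∀ z ∈ Metric.closedBall c r, ∃ k : ℕ,
      |hatAvgE U A z - a| ≤ 4 ^ n * M * (1 + k) ∧
        ∀ j < k, r - dist z c < 4 * r * (1 / 2) ^ j := by
    rcases le_or_gt (Metric.infDist c (frontier U)) (3 * r) with hd | hd
    · refine ⟨_, fun z hz => h.exists_abs_hatAvgE_sub_le hU hne hr hB hz ?_⟩
      have h1 := Metric.infDist_le_infDist_add_dist (s := frontier U) (x := z) (y := c)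
      have h2 : dist z c ≤ r := hz
      linarith
    · exact ⟨_, fun z hz => ⟨0, by simpa using h.abs_hatAvgE_sub_le_of_far hU hr hB hz hd,
        by simp⟩⟩
  obtain ⟨a, ha⟩ := key
  refine (oscillation_le_of_lintegral_le (volume_closedBall_toReal_pos c hr)
    ((h.aestronglyMeasurable_hatAvgE hU hne).mono_measure (Measure.restrict_mono hB le_rfl))
    (by positivity) (lintegral_closedBall_le_of_dyadic hn c hr ha)).trans (le_of_eq ?_)
  ring
end
end

section
/- Let h : ℝ → ℝ be an increasing homeomorphism. Then the Beurling–Ahlfors extension H, defined by H(x,y) = u(x,y) + i v(x,y) for y > 0 and H(x,0) = h(x), is a homeomorphism of the closed upper half-plane onto itself which maps the open upper half-plane onto itself. -/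
open MeasureTheory Set Function

noncomputable section

/-- The symmetric distortion function of an increasing homeomorphism `h : ℝ → ℝ`. -/
def rhoDist (h : ℝ → ℝ) (x t : ℝ) : ℝ :=
  max ((h (x + t) - h x) / (h x - h (x - t)))
      ((h x - h (x - t)) / (h (x + t) - h x))

/-- `u_x` partial derivative of the Beurling–Ahlfors extension. -/
def BAux (h : ℝ → ℝ) (x y : ℝ) : ℝ := (h (x + y) - h (x - y)) / (2 * y)

/-- `u_y` partial derivative of the Beurling–Ahlfors extension. -/
def BAuy (h : ℝ → ℝ) (x y : ℝ) : ℝ :=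
  (h (x + y) + h (x - y) - (1 / y) * (∫ t in x..(x + y), h t)
    - (1 / y) * (∫ t in (x - y)..x, h t)) / (2 * y)

/-- `v_x` partial derivative of the Beurling–Ahlfors extension. -/
def BAvx (h : ℝ → ℝ) (x y : ℝ) : ℝ := (h (x + y) + h (x - y) - 2 * h x) / (2 * y)

/-- `v_y` partial derivative of the Beurling–Ahlfors extension. -/
def BAvy (h : ℝ → ℝ) (x y : ℝ) : ℝ :=
  (h (x + y) - h (x - y) - (1 / y) * (∫ t in x..(x + y), h t)
    + (1 / y) * (∫ t in (x - y)..x, h t)) / (2 * y)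

/-- The quantity `(u_x² + u_y² + v_x² + v_y²)/(u_x v_y − u_y v_x)`, which equals
`K + 1/K` for the quasiconformal dilatation `K` of the Beurling–Ahlfors extension. -/
def BAdil (h : ℝ → ℝ) (x y : ℝ) : ℝ :=
  ((BAux h x y) ^ 2 + (BAuy h x y) ^ 2 + (BAvx h x y) ^ 2 + (BAvy h x y) ^ 2) /
    (BAux h x y * BAvy h x y - BAuy h x y * BAvx h x y)

/-- The open upper half-plane, as a subset of `ℝ × ℝ`. -/
def upperHP : Set (ℝ × ℝ) := {p | 0 < p.2}

/-- The density of the spherical measure `dσ = 4 dx dy/(1 + x² + y²)²`. -/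
def sphDen (p : ℝ × ℝ) : ℝ := 4 / (1 + p.1 ^ 2 + p.2 ^ 2) ^ 2

/-- The real part `u` of the Beurling–Ahlfors extension. -/
def BAu (h : ℝ → ℝ) (x y : ℝ) : ℝ := (1 / (2 * y)) * ∫ t in (x - y)..(x + y), h t

/-- The imaginary part `v` of the Beurling–Ahlfors extension. -/
def BAv (h : ℝ → ℝ) (x y : ℝ) : ℝ :=
  (1 / (2 * y)) * ((∫ t in x..(x + y), h t) - ∫ t in (x - y)..x, h t)

/-- The Beurling–Ahlfors extension of `h`, as a map `ℝ × ℝ → ℝ × ℝ`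
(defined to be `(h x, 0)` on the real line). -/
def BAext (h : ℝ → ℝ) (p : ℝ × ℝ) : ℝ × ℝ :=
  if 0 < p.2 then (BAu h p.1 p.2, BAv h p.1 p.2) else (h p.1, 0)

/-- The closed upper half-plane, as a subset of `ℝ × ℝ`. -/
def upperHPc : Set (ℝ × ℝ) := {p | 0 ≤ p.2}

/-- The mean of `h` over the segment from `x` to `x + y`, with value `h x` when `y = 0`. -/
def segMean (h : ℝ → ℝ) (x y : ℝ) : ℝ := ∫ s in (0 : ℝ)..1, h (x + y * s)

section SegMean

variable {h : ℝ → ℝ}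

lemma continuous_segMean (hc : Continuous h) :
    Continuous fun p : ℝ × ℝ => segMean h p.1 p.2 := by
  unfold segMean
  exact intervalIntegral.continuous_parametric_intervalIntegral_of_continuous' (by fun_prop) 0 1

@[simp] lemma segMean_zero (x : ℝ) : segMean h x 0 = h x := by simp [segMean]

lemma mul_segMean (x y : ℝ) : y * segMean h x y = ∫ t in x..(x + y), h t := by
  simp [segMean, intervalIntegral.mul_integral_comp_add_mul]

lemma segMean_lt (hc : Continuous h) {x y x' y' : ℝ}
    (hle : ∀ s ∈ Ioc (0 : ℝ) 1, h (x + y * s) ≤ h (x' + y' * s))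
    (hlt : h (x + y) < h (x' + y')) : segMean h x y < segMean h x' y' := by
  refine intervalIntegral.integral_lt_integral_of_continuousOn_of_le_of_exists_lt one_pos
    (by fun_prop) (by fun_prop) hle ⟨1, by simp, by simpa using hlt⟩

lemma segMean_strictMono_left (hc : Continuous h) (hm : StrictMono h) (y : ℝ) :
    StrictMono fun x => segMean h x y := fun x x' hx =>
  segMean_lt hc (fun s _ => hm.monotone (by linarith)) (hm (by linarith))

lemma segMean_strictMono_right (hc : Continuous h) (hm : StrictMono h) (x : ℝ) :
    StrictMono (segMean h x) := fun y y' hy =>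
  segMean_lt hc (fun s hs => hm.monotone (by nlinarith [hs.1])) (hm (by linarith))

/-- Splitting the segment at its midpoint bounds the mean from below. -/
lemma half_add_le_segMean (hc : Continuous h) (hm : StrictMono h) (x : ℝ) {y : ℝ} (hy : 0 ≤ y) :
    (h x + h (x + y / 2)) / 2 ≤ segMean h x y := by
  have hi : ∀ a b : ℝ, IntervalIntegrable (fun s => h (x + y * s)) volume a b := fun a b =>
    Continuous.intervalIntegrable (by fun_prop) a b
  have h1 : ∫ _ in (0 : ℝ)..(1 / 2), h x ≤ ∫ s in (0 : ℝ)..(1 / 2), h (x + y * s) :=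
    intervalIntegral.integral_mono_on (by norm_num) (by simp) (hi _ _)
      fun s hs => hm.monotone (by nlinarith [hs.1])
  have h2 : ∫ _ in (1 / 2 : ℝ)..1, h (x + y / 2) ≤ ∫ s in (1 / 2 : ℝ)..1, h (x + y * s) :=
    intervalIntegral.integral_mono_on (by norm_num) (by simp) (hi _ _)
      fun s hs => hm.monotone (by nlinarith [hs.1])
  have h3 := intervalIntegral.integral_add_adjacent_intervals (hi 0 (1 / 2)) (hi (1 / 2) 1)
  simp only [intervalIntegral.integral_const, smul_eq_mul] at h1 h2
  unfold segMean
  linarith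

/-- Splitting the segment at its midpoint bounds the mean from above. -/
lemma segMean_le_half_add (hc : Continuous h) (hm : StrictMono h) (x : ℝ) {y : ℝ} (hy : y ≤ 0) :
    segMean h x y ≤ (h x + h (x + y / 2)) / 2 := by
  have hi : ∀ a b : ℝ, IntervalIntegrable (fun s => h (x + y * s)) volume a b := fun a b =>
    Continuous.intervalIntegrable (by fun_prop) a b
  have h1 : ∫ s in (0 : ℝ)..(1 / 2), h (x + y * s) ≤ ∫ _ in (0 : ℝ)..(1 / 2), h x :=
    intervalIntegral.integral_mono_on (by norm_num) (hi _ _) (by simp)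
      fun s hs => hm.monotone (by nlinarith [hs.1])
  have h2 : ∫ s in (1 / 2 : ℝ)..1, h (x + y * s) ≤ ∫ _ in (1 / 2 : ℝ)..1, h (x + y / 2) :=
    intervalIntegral.integral_mono_on (by norm_num) (hi _ _) (by simp)
      fun s hs => hm.monotone (by nlinarith [hs.1])
  have h3 := intervalIntegral.integral_add_adjacent_intervals (hi 0 (1 / 2)) (hi (1 / 2) 1)
  simp only [intervalIntegral.integral_const, smul_eq_mul] at h1 h2
  unfold segMean
  linarith

lemma exists_lt_segMean (hc : Continuous h) (hm : StrictMono h) (hs : Surjective h) (x M : ℝ) :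
    ∃ y > 0, M < segMean h x y := by
  obtain ⟨z, hz⟩ := hs (2 * M - h x + 1)
  refine ⟨2 * max (z - x) 1, by positivity, ?_⟩
  have h1 := half_add_le_segMean hc hm x (y := 2 * max (z - x) 1) (by positivity)
  have h2 : h z ≤ h (x + 2 * max (z - x) 1 / 2) :=
    hm.monotone (by linarith [le_max_left (z - x) 1])
  linarith

lemma exists_segMean_lt (hc : Continuous h) (hm : StrictMono h) (hs : Surjective h) (x M : ℝ) :
    ∃ y < 0, segMean h x y < M := by
  obtain ⟨z, hz⟩ := hs (2 * M - h x - 1)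
  refine ⟨2 * min (z - x) (-1), by linarith [min_le_right (z - x) (-1)], ?_⟩
  have h1 := segMean_le_half_add hc hm x (y := 2 * min (z - x) (-1))
    (by linarith [min_le_right (z - x) (-1)])
  have h2 : h (x + 2 * min (z - x) (-1) / 2) ≤ h z :=
    hm.monotone (by linarith [min_le_left (z - x) (-1)])
  linarith

lemma segMean_surjective_left (hc : Continuous h) (hm : StrictMono h) (hs : Surjective h)
    (y : ℝ) : Surjective fun x => segMean h x y := by
  have hcy : Continuous fun x => segMean h x y :=
    (continuous_segMean hc).comp (by fun_prop : Continuous fun x : ℝ => (x, y))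
  have hconst : ∀ c : ℝ, ∫ _ in (0 : ℝ)..1, h c = h c := fun c => by simp
  refine fun A => mem_range_of_exists_le_of_exists_ge hcy ?_ ?_
  all_goals
    obtain ⟨z, hz⟩ := hs A
  · refine ⟨z - |y|, ?_⟩
    rw [← hz, ← hconst z]
    refine intervalIntegral.integral_mono_on zero_le_one
      (Continuous.intervalIntegrable (by fun_prop) _ _) (by simp) fun s hs => hm.monotone ?_
    nlinarith [hs.1, hs.2, le_abs_self y, abs_nonneg y]
  · refine ⟨z + |y|, ?_⟩
    rw [← hz, ← hconst z]
    refine intervalIntegral.integral_mono_on zero_le_one (by simp)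
      (Continuous.intervalIntegrable (by fun_prop) _ _) fun s hs => hm.monotone ?_
    nlinarith [hs.1, hs.2, neg_abs_le y, abs_nonneg y]

/-- The pair of one-sided means of `h` over `[x, x + y]` and `[x - y, x]`. -/
def segMeanPair (h : ℝ → ℝ) (p : ℝ × ℝ) : ℝ × ℝ := (segMean h p.1 p.2, segMean h p.1 (-p.2))

lemma continuous_segMeanPair (hc : Continuous h) : Continuous (segMeanPair h) :=
  (continuous_segMean hc).prodMk
    ((continuous_segMean hc).comp (by fun_prop : Continuous fun p : ℝ × ℝ => (p.1, -p.2)))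

lemma segMeanPair_injective (hc : Continuous h) (hm : StrictMono h) :
    Injective (segMeanPair h) := by
  have key : ∀ x y x' y' : ℝ, x < x' → segMean h x y = segMean h x' y' → y' < y := by
    intro x y x' y' hx he
    by_contra! hy
    have h1 := segMean_strictMono_left hc hm y hx
    have h2 := (segMean_strictMono_right hc hm x').monotone hy
    dsimp only at h1
    linarith
  rintro ⟨x, y⟩ ⟨x', y'⟩ he
  simp only [segMeanPair, Prod.mk.injEq] at he
  rcases lt_trichotomy x x' with hx | rfl | hx
  · linarith [key _ _ _ _ hx he.1, key _ _ _ _ hx he.2]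
  · rw [(segMean_strictMono_right hc hm x).injective he.1]
  · linarith [key _ _ _ _ hx he.1.symm, key _ _ _ _ hx he.2.symm]

lemma segMeanPair_surjective (hc : Continuous h) (hm : StrictMono h) (hs : Surjective h) :
    Surjective (segMeanPair h) := by
  rintro ⟨A, B⟩
  choose X hX using fun y => segMean_surjective_left hc hm hs y A
  dsimp only at hX
  have hXc : Continuous X := by
    refine continuous_iff_continuousAt.2 fun y₀ => tendsto_order.2 ⟨fun c hlt => ?_, fun c hlt => ?_⟩
    all_goals
      have hcont : Continuous (segMean h c) :=
        (continuous_segMean hc).comp (by fun_prop : Continuous fun y : ℝ => (c, y))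
      have h1 := segMean_strictMono_left hc hm y₀ hlt
      dsimp only at h1
      rw [hX] at h1
    · filter_upwards [hcont.continuousAt.eventually_lt continuousAt_const h1] with y hy
      rw [← hX y] at hy
      exact (segMean_strictMono_left hc hm y).lt_iff_lt.1 hy
    · filter_upwards [continuousAt_const.eventually_lt hcont.continuousAt h1] with y hy
      rw [← hX y] at hy
      exact (segMean_strictMono_left hc hm y).lt_iff_lt.1 hy
  have hgc : Continuous fun y => segMean h (X y) (-y) :=
    (continuous_segMean hc).comp (hXc.prodMk continuous_neg)
  obtain ⟨c, rfl⟩ := hs A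
  have hXneg : ∀ y, 0 < y → X y ≤ c := fun y hy => by
    refine hm.le_iff_le.1 ?_
    rw [← hX y, ← segMean_zero (h := h) (X y)]
    exact (segMean_strictMono_right hc hm _).monotone hy.le
  have hXpos : ∀ y, y < 0 → c ≤ X y := fun y hy => by
    refine hm.le_iff_le.1 ?_
    rw [← hX y, ← segMean_zero (h := h) (X y)]
    exact (segMean_strictMono_right hc hm _).monotone hy.le
  obtain ⟨y, hy⟩ : B ∈ range fun y => segMean h (X y) (-y) := by
    refine mem_range_of_exists_le_of_exists_ge hgc ?_ ?_
    · obtain ⟨y, hy, hlt⟩ := exists_segMean_lt hc hm hs c B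
      refine ⟨-y, le_trans ?_ hlt.le⟩
      rw [neg_neg]
      exact (segMean_strictMono_left hc hm y).monotone (hXneg _ (by linarith))
    · obtain ⟨y, hy, hlt⟩ := exists_lt_segMean hc hm hs c B
      refine ⟨-y, hlt.le.trans ?_⟩
      rw [neg_neg]
      exact (segMean_strictMono_left hc hm y).monotone (hXpos _ (by linarith))
  exact ⟨(X y, y), Prod.ext (hX y) hy⟩

lemma isProperMap_segMeanPair (hc : Continuous h) (hm : StrictMono h) (hs : Surjective h) :
    IsProperMap (segMeanPair h) := by
  refine isProperMap_iff_isCompact_preimage.2 ⟨continuous_segMeanPair hc, fun K hK => ?_⟩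
  obtain ⟨M, hM⟩ := hK.isBounded.exists_norm_le
  obtain ⟨c, hcM⟩ := hs (-M)
  obtain ⟨d, hdM⟩ := hs M
  obtain ⟨R, hR, hlt⟩ := exists_lt_segMean hc hm hs c M
  refine (isCompact_Icc (a := ((c, -R) : ℝ × ℝ)) (b := (d, R))).of_isClosed_subset
    (hK.isClosed.preimage (continuous_segMeanPair hc)) ?_
  rintro ⟨x, y⟩ hp
  have hb := hM _ hp
  simp only [segMeanPair, Prod.norm_def, Real.norm_eq_abs, sup_le_iff, abs_le] at hb
  obtain ⟨⟨hb1, hb2⟩, hb3, hb4⟩ := hb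
  have hmono := (segMean_strictMono_right hc hm x).monotone
  have hx : -M ≤ h x ∧ h x ≤ M := by
    rw [← segMean_zero (h := h) x]
    rcases le_total 0 y with hy | hy
    · exact ⟨hb3.trans (hmono (by linarith)), (hmono hy).trans hb2⟩
    · exact ⟨hb1.trans (hmono hy), (hmono (by linarith)).trans hb4⟩
  rw [← hcM, ← hdM, hm.le_iff_le, hm.le_iff_le] at hx
  have hbound : ∀ z, segMean h x z ≤ M → z ≤ R := fun z hz => by
    by_contra! hRz
    have h1 : segMean h c R ≤ segMean h x R := (segMean_strictMono_left hc hm R).monotone hx.1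
    linarith [hmono hRz.le]
  exact ⟨⟨hx.1, by linarith [hbound _ hb4]⟩, ⟨hx.2, hbound _ hb2⟩⟩

/-- The two one-sided means are global coordinates on the plane. -/
def segMeanHomeo (hc : Continuous h) (hm : StrictMono h) (hs : Surjective h) :
    ℝ × ℝ ≃ₜ ℝ × ℝ :=
  (Equiv.ofBijective (segMeanPair h)
    ⟨segMeanPair_injective hc hm, segMeanPair_surjective hc hm hs⟩).toHomeomorphOfContinuousClosed
    (continuous_segMeanPair hc) (isProperMap_segMeanPair hc hm hs).isClosedMap

end SegMean

/-- The linear change of coordinates `(a, b) ↦ ((a + b) / 2, (a - b) / 2)` of the plane. -/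
def halfSumDiff : ℝ × ℝ ≃ₜ ℝ × ℝ where
  toFun p := ((p.1 + p.2) / 2, (p.1 - p.2) / 2)
  invFun q := (q.1 + q.2, q.1 - q.2)
  left_inv p := by ext <;> dsimp only <;> ring
  right_inv q := by ext <;> dsimp only <;> ring
  continuous_toFun := by fun_prop
  continuous_invFun := by fun_prop

lemma halfSumDiff_apply (p : ℝ × ℝ) :
    halfSumDiff p = ((p.1 + p.2) / 2, (p.1 - p.2) / 2) := rfl

lemma BAext_eq_halfSumDiff {h : ℝ → ℝ} (hc : Continuous h) {p : ℝ × ℝ} (hp : 0 ≤ p.2) :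
    BAext h p = halfSumDiff (segMeanPair h p) := by
  obtain ⟨x, y⟩ := p
  rcases (show 0 ≤ y from hp).eq_or_lt with rfl | hy
  · simp [BAext, halfSumDiff_apply, segMeanPair]
  · have h1 := mul_segMean (h := h) x y
    have h2 := mul_segMean (h := h) x (-y)
    rw [intervalIntegral.integral_symm, ← sub_eq_add_neg] at h2
    have h3 : ∫ t in (x - y)..(x + y), h t = y * segMean h x y + y * segMean h x (-y) := by
      rw [← intervalIntegral.integral_add_adjacent_intervals
        (hc.intervalIntegrable (x - y) x) (hc.intervalIntegrable x (x + y))]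
      linarith
    have h4 : (∫ t in x..(x + y), h t) - ∫ t in (x - y)..x, h t =
        y * segMean h x y - y * segMean h x (-y) := by linarith
    simp only [BAext, BAu, BAv, hy, if_true, h3, h4]
    ext <;> simp only [halfSumDiff_apply, segMeanPair] <;> field_simp

/-- For an increasing homeomorphism `h : ℝ → ℝ`, the Beurling–Ahlfors
extension (equal to `h` on the real line) is a homeomorphism of the closed upper half-plane
onto itself which maps the open upper half-plane onto itself. -/
theorem beurling_ahlfors_extension_homeo (h : ℝ → ℝ) (hmono : StrictMono h)
    (hsurj : Surjective h) :
    (∃ E : upperHPc ≃ₜ upperHPc, ∀ p : upperHPc, (E p : ℝ × ℝ) = BAext h p) ∧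
    Set.BijOn (BAext h) upperHP upperHP := by
  have hc : Continuous h := hmono.monotone.continuous_of_surjective hsurj
  let Φ : ℝ × ℝ ≃ₜ ℝ × ℝ := (segMeanHomeo hc hmono hsurj).trans halfSumDiff
  have hΦ : ∀ p : ℝ × ℝ, 0 ≤ p.2 → BAext h p = Φ p := fun p hp => BAext_eq_halfSumDiff hc hp
  have hΦ2 : ∀ p : ℝ × ℝ, (Φ p).2 = (segMean h p.1 p.2 - segMean h p.1 (-p.2)) / 2 :=
    fun _ => rfl
  have hlt : ∀ p : ℝ × ℝ, p ∈ upperHP ↔ Φ p ∈ upperHP := fun p => by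
    have := (segMean_strictMono_right hc hmono p.1).lt_iff_lt (a := -p.2) (b := p.2)
    simp only [upperHP, mem_ofPred_eq, hΦ2]
    constructor
    · intro hp
      linarith [this.2 (by linarith)]
    · intro hp
      linarith [this.1 (by linarith)]
  have hle : ∀ p : ℝ × ℝ, p ∈ upperHPc ↔ Φ p ∈ upperHPc := fun p => by
    have := (segMean_strictMono_right hc hmono p.1).le_iff_le (a := -p.2) (b := p.2)
    simp only [upperHPc, mem_ofPred_eq, hΦ2]
    constructor
    · intro hp
      linarith [this.2 (by linarith)]
    · intro hp
      linarith [this.1 (by linarith)]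
  refine ⟨⟨Φ.subtype hle, fun p => (hΦ p p.2).symm⟩, ?_⟩
  refine BijOn.congr (f₁ := Φ) ⟨fun p hp => (hlt p).1 hp, Φ.injective.injOn, fun q hq => ?_⟩
    fun p hp => (hΦ p (le_of_lt hp)).symm
  exact ⟨Φ.symm q, (hlt _).2 (by simpa using hq), by simp⟩
end
end

section
/- Let h : ℝ → ℝ be an increasing homeomorphism and let H = u + iv be its Beurling–Ahlfors extension. Then at every point (x,y) with y > 0, the functions u and v are differentiable, with partial derivatives u_x(x,y) = (h(x+y) − h(x−y))/(2y), u_y(x,y) = (1/(2y))( h(x+y) + h(x−y) − (1/y)∫_x^{x+y} h(t) dt − (1/y)∫_{x−y}^{x} h(t) dt ), v_x(x,y) = (h(x+y) + h(x−y) − 2h(x))/(2y), and v_y(x,y) = (1/(2y))( h(x+y) − h(x−y) − (1/y)∫_x^{x+y} h(t) dt + (1/y)∫_{x−y}^{x} h(t) dt ); moreover the Jacobian u_x v_y − u_y v_x is strictly positive. -/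
open MeasureTheory Set Function

noncomputable section

/-- Over an interval of positive length, the integral of a continuous strictly increasing function
is less than the length times the value at the right endpoint. -/
theorem StrictMono.intervalIntegral_lt_right {h : ℝ → ℝ} (hmono : StrictMono h)
    (hc : Continuous h) {a b : ℝ} (hab : a < b) : ∫ t in a..b, h t < (b - a) * h b := by
  have := intervalIntegral.integral_lt_integral_of_continuousOn_of_le_of_exists_lt hab
    hc.continuousOn (continuousOn_const (c := h b)) (fun t ht => hmono.monotone ht.2)
    ⟨a, left_mem_Icc.2 hab.le, hmono hab⟩
  simpa using this

/-- Over an interval of positive length, the integral of a continuous strictly increasing function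
is greater than the length times the value at the left endpoint. -/
theorem StrictMono.left_lt_intervalIntegral {h : ℝ → ℝ} (hmono : StrictMono h)
    (hc : Continuous h) {a b : ℝ} (hab : a < b) : (b - a) * h a < ∫ t in a..b, h t := by
  have := intervalIntegral.integral_lt_integral_of_continuousOn_of_le_of_exists_lt hab
    (continuousOn_const (c := h a)) hc.continuousOn (fun t ht => hmono.monotone ht.1.le)
    ⟨b, right_mem_Icc.2 hab.le, hmono hab⟩
  simpa using this

/-- The derivative of the integral of a continuous function between two differentiable
endpoints. -/
theorem HasFDerivAt.intervalIntegral_of_continuous {E : Type*} [NormedAddCommGroup E]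
    [NormedSpace ℝ E] {h : ℝ → ℝ} (hc : Continuous h) {f g : E → ℝ} {f' g' : E →L[ℝ] ℝ} {p : E}
    (hf : HasFDerivAt f f' p) (hg : HasFDerivAt g g' p) :
    HasFDerivAt (fun q => ∫ t in f q..g q, h t) (h (g p) • g' - h (f p) • f') p := by
  have hF : ∀ s : ℝ, HasDerivAt (fun z => ∫ t in (0 : ℝ)..z, h t) (h s) s := fun s =>
    hc.integral_hasStrictDerivAt 0 s |>.hasDerivAt
  have hsub := ((hF (g p)).comp_hasFDerivAt p hg).sub ((hF (f p)).comp_hasFDerivAt p hf)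
  refine hsub.congr_of_eventuallyEq (Filter.Eventually.of_forall fun q => ?_)
  exact (intervalIntegral.integral_interval_sub_left (hc.intervalIntegrable _ _)
    (hc.intervalIntegrable _ _)).symm

/-- The derivative of a function divided by twice the second coordinate. -/
theorem HasFDerivAt.one_div_two_mul_snd_mul {I : ℝ × ℝ → ℝ} {I' : ℝ × ℝ →L[ℝ] ℝ} {p : ℝ × ℝ}
    (hI : HasFDerivAt I I' p) (hp : p.2 ≠ 0) :
    HasFDerivAt (fun q : ℝ × ℝ => 1 / (2 * q.2) * I q)
      ((1 / (2 * p.2)) • I' - (I p / (2 * p.2 ^ 2)) • ContinuousLinearMap.snd ℝ ℝ ℝ) p := by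
  have hd : HasDerivAt (fun y : ℝ => 1 / (2 * y)) (-1 / (2 * p.2 ^ 2)) p.2 := by
    refine (((hasDerivAt_inv hp).div_const 2).congr_deriv (by field_simp)).congr_of_eventuallyEq
      (Filter.Eventually.of_forall fun y => ?_)
    simp only [mul_inv, div_eq_mul_inv]
    ring
  refine ((hd.comp_hasFDerivAt p hasFDerivAt_snd).mul hI).congr_fderiv ?_
  ext
  · simp
  · simp
    ring

/-- For an increasing homeomorphism `h : ℝ → ℝ`, the components `u`, `v` of
the Beurling–Ahlfors extension are differentiable at every point of the open upper
half-plane, with the stated partial derivatives, and the Jacobian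
`u_x v_y − u_y v_x` is strictly positive there. -/
theorem beurling_ahlfors_extension_derivatives (h : ℝ → ℝ) (hmono : StrictMono h)
    (hsurj : Surjective h) :
    ∀ x y : ℝ, 0 < y →
      HasFDerivAt (fun p : ℝ × ℝ => BAu h p.1 p.2)
        (BAux h x y • ContinuousLinearMap.fst ℝ ℝ ℝ +
          BAuy h x y • ContinuousLinearMap.snd ℝ ℝ ℝ) (x, y) ∧
      HasFDerivAt (fun p : ℝ × ℝ => BAv h p.1 p.2)
        (BAvx h x y • ContinuousLinearMap.fst ℝ ℝ ℝ +
          BAvy h x y • ContinuousLinearMap.snd ℝ ℝ ℝ) (x, y) ∧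
      0 < BAux h x y * BAvy h x y - BAuy h x y * BAvx h x y := by
  intro x y hy
  have hc : Continuous h := hmono.monotone.continuous_of_surjective hsurj
  have hx : HasFDerivAt (fun p : ℝ × ℝ => p.1) (ContinuousLinearMap.fst ℝ ℝ ℝ) (x, y) :=
    hasFDerivAt_fst
  have hs : HasFDerivAt (fun p : ℝ × ℝ => p.2) (ContinuousLinearMap.snd ℝ ℝ ℝ) (x, y) :=
    hasFDerivAt_snd
  refine ⟨?_, ?_, ?_⟩
  · refine ((HasFDerivAt.intervalIntegral_of_continuous hc (hx.sub hs)
      (hx.add hs)).one_div_two_mul_snd_mul hy.ne').congr_fderiv ?_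
    have hsplit := intervalIntegral.integral_add_adjacent_intervals
      (hc.intervalIntegrable (μ := volume) (x - y) x) (hc.intervalIntegrable x (x + y))
    ext
    · simp [BAux]
      ring
    · simp [BAuy, ← hsplit]
      field_simp
      ring
  · refine (((HasFDerivAt.intervalIntegral_of_continuous hc hx (hx.add hs)).sub
      (HasFDerivAt.intervalIntegral_of_continuous hc (hx.sub hs)
        hx)).one_div_two_mul_snd_mul hy.ne').congr_fderiv ?_
    ext
    · simp [BAvx]
      ring
    · simp [BAvy]
      field_simp
      ring
  · have hp : 0 < h (x + y) - 1 / y * ∫ t in x..(x + y), h t := by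
      have := hmono.intervalIntegral_lt_right hc (lt_add_of_pos_right x hy)
      rw [sub_pos, one_div_mul_eq_div, div_lt_iff₀ hy]
      linarith
    have hq : 0 < (1 / y * ∫ t in (x - y)..x, h t) - h (x - y) := by
      have := hmono.left_lt_intervalIntegral hc (sub_lt_self x hy)
      rw [sub_pos, one_div_mul_eq_div, lt_div_iff₀ hy]
      linarith
    have hr : 0 < h (x + y) - h x := sub_pos.2 (hmono (lt_add_of_pos_right x hy))
    have hl : 0 < h x - h (x - y) := sub_pos.2 (hmono (sub_lt_self x hy))
    have hJ : BAux h x y * BAvy h x y - BAuy h x y * BAvx h x y =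
        2 * ((h (x + y) - h x) * ((1 / y * ∫ t in (x - y)..x, h t) - h (x - y)) +
          (h x - h (x - y)) * (h (x + y) - 1 / y * ∫ t in x..(x + y), h t)) / (2 * y) ^ 2 := by
      simp only [BAux, BAuy, BAvx, BAvy]
      ring
    rw [hJ]
    positivity
end
end

section
/- Let h : ℝ → ℝ be an increasing homeomorphism with h(0) = 0 and h(1) = 1, and set A = 4 ∫₀^{1/4} ρ_h(t, 1−t) dt. Then ∫₀^{1/4} h(t) dt ≤ 1/4 + h(−1/2)/(4(1+A)). -/
open MeasureTheory Set Function

noncomputable section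

/-- For `t ≤ 1/4` the interval `[2t - 1, t]` contains `[-1/2, t]`, which bounds `ρ_h(t, 1 - t)`
from below. -/
theorem le_one_add_rhoDist_mul {h : ℝ → ℝ} (hmono : StrictMono h) (h1 : h 1 = 1) {t : ℝ}
    (ht : t ≤ 1 / 4) :
    1 - h (-(1 / 2)) ≤ (1 + rhoDist h t (1 - t)) * (1 - h t) := by
  have hlt : h t < 1 := h1 ▸ hmono (by linarith)
  have hle : h (t - (1 - t)) ≤ h (-(1 / 2)) := hmono.monotone (by linarith)
  have hρ : (h t - h (t - (1 - t))) / (1 - h t) ≤ rhoDist h t (1 - t) := by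
    unfold rhoDist
    rw [add_sub_cancel, h1]
    exact le_max_right _ _
  rw [div_le_iff₀ (by linarith)] at hρ
  linarith

theorem rhoDist_nonneg {h : ℝ → ℝ} (hmono : Monotone h) (x : ℝ) {t : ℝ} (ht : 0 ≤ t) :
    0 ≤ rhoDist h x t :=
  le_max_of_le_left <| div_nonneg (sub_nonneg.2 (hmono (by linarith)))
    (sub_nonneg.2 (hmono (by linarith)))

theorem continuousOn_rhoDist {h : ℝ → ℝ} (hmono : StrictMono h) (hc : Continuous h) :
    ContinuousOn (fun t => rhoDist h t (1 - t)) (Iio 1) := by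
  unfold rhoDist
  refine ContinuousOn.sup ?_ ?_
  · refine ContinuousOn.div (by fun_prop) (by fun_prop) fun t (ht : t < 1) => ?_
    exact (sub_pos.2 (hmono (by linarith))).ne'
  · refine ContinuousOn.div (by fun_prop) (by fun_prop) fun t (ht : t < 1) => ?_
    exact (sub_pos.2 (hmono (by linarith))).ne'

/-- The tangent line of `x ↦ 1/x` at `m` lies below its graph. -/
theorem two_div_sub_div_sq_le {m u : ℝ} (hm : 0 < m) (hu : 0 < u) :
    2 / m - u / m ^ 2 ≤ 1 / u := by
  have key : 1 / u - (2 / m - u / m ^ 2) = (m - u) ^ 2 / (u * m ^ 2) := by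
    field_simp
    ring
  have : 0 ≤ (m - u) ^ 2 / (u * m ^ 2) := by positivity
  linarith

/-- For an increasing homeomorphism `h` of `ℝ` with `h(0) = 0`, `h(1) = 1`,
setting `A = 4∫₀^{1/4} ρ_h(t, 1−t) dt`, one has
`∫₀^{1/4} h ≤ 1/4 + h(−1/2)/(4(1+A))`. -/
theorem step_one_estimate (h : ℝ → ℝ) (hmono : StrictMono h) (hsurj : Surjective h)
    (h0 : h 0 = 0) (h1 : h 1 = 1) :
    ∫ t in (0 : ℝ)..(1 / 4), h t ≤
      1 / 4 + h (-(1 / 2)) /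
        (4 * (1 + 4 * ∫ t in (0 : ℝ)..(1 / 4), rhoDist h t (1 - t))) := by
  have hc : Continuous h := hmono.monotone.continuous_of_surjective hsurj
  have hint : IntervalIntegrable (fun t => rhoDist h t (1 - t)) volume 0 (1 / 4) := by
    refine ((continuousOn_rhoDist hmono hc).mono fun t ht => ?_).intervalIntegrable
    rw [uIcc_of_le (by norm_num)] at ht
    exact lt_of_le_of_lt ht.2 (by norm_num)
  have hI : 0 ≤ ∫ t in (0 : ℝ)..(1 / 4), rhoDist h t (1 - t) :=
    intervalIntegral.integral_nonneg (by norm_num) fun t ht =>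
      rhoDist_nonneg hmono.monotone t (by linarith [ht.2])
  set I := ∫ t in (0 : ℝ)..(1 / 4), rhoDist h t (1 - t) with hIdef
  set m := 1 + 4 * I with hm
  have hm0 : 0 < m := by positivity
  have ha : h (-(1 / 2)) < 0 := h0 ▸ hmono (by norm_num)
  set b := h (-(1 / 2)) with hb
  have hpt : ∀ t ∈ Icc (0 : ℝ) (1 / 4),
      h t ≤ (1 + b * (2 / m - 1 / m ^ 2)) - b / m ^ 2 * rhoDist h t (1 - t) := by
    intro t ht
    have hu : 0 < 1 + rhoDist h t (1 - t) := by
      linarith [rhoDist_nonneg hmono.monotone t (t := 1 - t) (by linarith [ht.2])]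
    have hle : -b * (1 / (1 + rhoDist h t (1 - t))) ≤ 1 - h t := by
      rw [mul_one_div, div_le_iff₀ hu]
      linarith [le_one_add_rhoDist_mul hmono h1 ht.2]
    have htan := mul_le_mul_of_nonneg_left (two_div_sub_div_sq_le hm0 hu) (neg_nonneg.2 ha.le)
    have : -b * (2 / m - (1 + rhoDist h t (1 - t)) / m ^ 2) =
        -(b * (2 / m - 1 / m ^ 2) - b / m ^ 2 * rhoDist h t (1 - t)) := by ring
    linarith
  calc ∫ t in (0 : ℝ)..(1 / 4), h t
      ≤ ∫ t in (0 : ℝ)..(1 / 4),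
          ((1 + b * (2 / m - 1 / m ^ 2)) - b / m ^ 2 * rhoDist h t (1 - t)) :=
        intervalIntegral.integral_mono_on (by norm_num) (hc.intervalIntegrable _ _)
          (intervalIntegrable_const.sub (hint.const_mul _)) hpt
    _ = 1 / 4 * (1 + b * (2 / m - 1 / m ^ 2)) - b / m ^ 2 * I := by
        rw [intervalIntegral.integral_sub intervalIntegrable_const (hint.const_mul _),
          intervalIntegral.integral_const, intervalIntegral.integral_const_mul, ← hIdef]
        simp
    _ = 1 / 4 + b / (4 * m) := by
        have : I = (m - 1) / 4 := by rw [hm]; ring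
        rw [this]
        field_simp
        ring
end
end

section
/- Let h : ℝ → ℝ be an increasing homeomorphism with h(0) = 0 and h(1) = 1, and suppose h(−1/2) ≤ h(−1)/2. Set β = −h(−1), ξ = 1 − ∫₀¹ h(t) dt, η = 1 + (1/β) ∫_{−1}^0 h(t) dt, and A = 4 ∫₀^{1/4} ρ_h(t, 1−t) dt. Then 4ξ + (2/3)·(β/(1+A))·η ≥ (2/3)·β/(1+A). -/
open MeasureTheory Set Function

noncomputable section

/-- The tangent line of `w ↦ 1 / w` at `1 / l` lies below its graph. -/
lemma two_mul_sub_sq_mul_le_inv {w : ℝ} (hw : 0 < w) (l : ℝ) : 2 * l - l ^ 2 * w ≤ 1 / w := by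
  rw [le_div_iff₀ hw]
  nlinarith [sq_nonneg (l * w - 1)]

/-- Linear lower bound for `1 + ρ_h(t, 1 - t)` in terms of `h(t)`. -/
lemma linear_le_one_add_rhoDist {h : ℝ → ℝ} (hmono : StrictMono h) (h1 : h 1 = 1)
    {t c : ℝ} (hc : 0 ≤ c) (ht : t < 1) (hct : h (2 * t - 1) ≤ 1 - c) (l : ℝ) :
    c * (2 * l - l ^ 2 * (1 - h t)) ≤ 1 + rhoDist h t (1 - t) := by
  have hw : 0 < 1 - h t := by linarith [hmono ht]
  have hρ : (h t - h (2 * t - 1)) / (1 - h t) ≤ rhoDist h t (1 - t) := by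
    unfold rhoDist
    rw [show t + (1 - t) = 1 by ring, show t - (1 - t) = 2 * t - 1 by ring, h1]
    exact le_max_right _ _
  have hsum : 1 + (h t - h (2 * t - 1)) / (1 - h t) = (1 - h (2 * t - 1)) / (1 - h t) := by
    field_simp
    ring
  calc c * (2 * l - l ^ 2 * (1 - h t)) ≤ c * (1 / (1 - h t)) :=
        mul_le_mul_of_nonneg_left (two_mul_sub_sq_mul_le_inv hw l) hc
    _ = c / (1 - h t) := by ring
    _ ≤ (1 - h (2 * t - 1)) / (1 - h t) := by gcongr; linarith
    _ ≤ 1 + rhoDist h t (1 - t) := by linarith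

lemma continuousOn_rhoDist_one_sub {h : ℝ → ℝ} (hmono : StrictMono h) (hcont : Continuous h) :
    ContinuousOn (fun t => rhoDist h t (1 - t)) (Iio 1) := by
  unfold rhoDist
  refine ContinuousOn.sup (ContinuousOn.div (by fun_prop) (by fun_prop) fun t ht => ?_)
    (ContinuousOn.div (by fun_prop) (by fun_prop) fun t ht => ?_)
  · exact (sub_pos.2 (hmono (by linarith [mem_Iio.1 ht]))).ne'
  · exact (sub_pos.2 (hmono (by linarith [mem_Iio.1 ht]))).ne'

/-- A Cauchy–Schwarz type bound relating `∫₀¹ (1 - h)` and `4 ∫₀^{1/4} ρ_h(t, 1 - t) dt`. -/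
lemma one_sub_div_four_le_mul {h : ℝ → ℝ} (hmono : StrictMono h) (hcont : Continuous h)
    (h0 : h 0 = 0) (h1 : h 1 = 1) :
    0 < 1 - ∫ t in (0 : ℝ)..1, h t ∧
    (1 - h (-(1 / 2))) / 4 ≤ (1 - ∫ t in (0 : ℝ)..1, h t) *
      (1 + 4 * ∫ t in (0 : ℝ)..(1 / 4), rhoDist h t (1 - t)) := by
  set ξ := 1 - ∫ t in (0 : ℝ)..1, h t with hξ
  set c := 1 - h (-(1 / 2)) with hc
  have hc0 : 0 < c := by
    have := hmono (show (-(1 / 2) : ℝ) < 0 by norm_num)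
    linarith
  have hi : ∀ a b, IntervalIntegrable h volume a b := fun a b => hcont.intervalIntegrable a b
  have hi' : ∀ a b, IntervalIntegrable (fun t => 1 - h t) volume a b := fun a b =>
    (continuous_const.sub hcont).intervalIntegrable a b
  have hξ' : ξ = ∫ t in (0 : ℝ)..1, (1 - h t) := by
    rw [intervalIntegral.integral_sub (by simp) (hi _ _)]
    simp [hξ]
  have hsplit : (∫ t in (0 : ℝ)..(1 / 4), (1 - h t)) + ∫ t in (1 / 4 : ℝ)..1, (1 - h t) = ξ := by
    rw [hξ', intervalIntegral.integral_add_adjacent_intervals (hi' _ _) (hi' _ _)]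
  have hnonneg : 0 ≤ ∫ t in (1 / 4 : ℝ)..1, (1 - h t) :=
    intervalIntegral.integral_nonneg (by norm_num) fun t ht => by
      linarith [hmono.monotone ht.2]
  have hpos : 0 < ∫ t in (0 : ℝ)..(1 / 4), (1 - h t) :=
    intervalIntegral.intervalIntegral_pos_of_pos_on (hi' _ _) (fun t ht => by
      linarith [hmono (show t < 1 by linarith [ht.2])]) (by norm_num)
  have hξ0 : 0 < ξ := by linarith
  refine ⟨hξ0, ?_⟩
  set l := 1 / (4 * ξ) with hl
  have hρi : IntervalIntegrable (fun t => rhoDist h t (1 - t)) volume 0 (1 / 4) := by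
    refine ((continuousOn_rhoDist_one_sub hmono hcont).mono fun t ht => ?_).intervalIntegrable
    rw [uIcc_of_le (by norm_num)] at ht
    exact mem_Iio.2 (by linarith [ht.2])
  have hmain : ∫ t in (0 : ℝ)..(1 / 4), c * (2 * l - l ^ 2 * (1 - h t)) ≤
      ∫ t in (0 : ℝ)..(1 / 4), (1 + rhoDist h t (1 - t)) := by
    refine intervalIntegral.integral_mono_on (by norm_num)
      (Continuous.intervalIntegrable (by fun_prop) _ _) (IntervalIntegrable.add (by simp) hρi)
      fun t ht => linear_le_one_add_rhoDist hmono h1 hc0.le (by linarith [ht.2]) ?_ l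
    have := hmono.monotone (show 2 * t - 1 ≤ -(1 / 2) by linarith [ht.2])
    linarith
  rw [intervalIntegral.integral_const_mul, intervalIntegral.integral_sub (by simp)
    ((hi' _ _).const_mul _),
    intervalIntegral.integral_add (by simp) hρi] at hmain
  simp only [intervalIntegral.integral_const_mul, intervalIntegral.integral_const,
    smul_eq_mul] at hmain
  set I := ∫ t in (0 : ℝ)..(1 / 4), (1 - h t)
  set R := ∫ t in (0 : ℝ)..(1 / 4), rhoDist h t (1 - t)
  have hlow : c * (1 / (16 * ξ)) ≤ 1 / 4 + R := by
    have hlI : l ^ 2 * I ≤ l ^ 2 * ξ := by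
      gcongr
      linarith
    have hlξ : (1 / 4 - 0) * (2 * l) - l ^ 2 * ξ = 1 / (16 * ξ) := by
      rw [hl]
      field_simp
      norm_num
    calc c * (1 / (16 * ξ)) ≤ c * ((1 / 4 - 0) * (2 * l) - l ^ 2 * I) := by
          gcongr
          linarith
      _ ≤ 1 / 4 + R := by linarith
  calc c / 4 = 4 * ξ * (c * (1 / (16 * ξ))) := by
        field_simp
        norm_num
    _ ≤ 4 * ξ * (1 / 4 + R) := by gcongr
    _ = ξ * (1 + 4 * R) := by ring

lemma average_endpoints_le_integral {h : ℝ → ℝ} (hmono : Monotone h) :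
    (h (-1) + h (-(1 / 2))) / 2 ≤ ∫ t in (-1 : ℝ)..0, h t := by
  have hi : ∀ a b, IntervalIntegrable h volume a b := fun a b => hmono.intervalIntegrable
  have hbound : ∀ a b, a ≤ b → (b - a) * h a ≤ ∫ t in a..b, h t := fun a b hab => by
    have := intervalIntegral.integral_mono_on hab (intervalIntegrable_const (c := h a)) (hi a b)
      fun t ht => hmono ht.1
    simpa using this
  rw [← intervalIntegral.integral_add_adjacent_intervals (hi (-1) (-(1 / 2))) (hi _ 0)]
  have hleft := hbound (-1) (-(1 / 2)) (by norm_num)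
  have hright := hbound (-(1 / 2)) 0 (by norm_num)
  linarith

/-- For an increasing homeomorphism `h` of `ℝ` with `h(0) = 0`, `h(1) = 1`
and `h(−1/2) ≤ h(−1)/2`, setting `β = −h(−1)`, `ξ = 1 − ∫₀¹ h`, `η = 1 + (1/β)∫_{−1}^0 h`,
and `A = 4∫₀^{1/4} ρ_h(t, 1−t) dt`, one has `4ξ + (2/3)(β/(1+A))η ≥ (2/3)β/(1+A)`. -/
theorem step_two_estimate (h : ℝ → ℝ) (hmono : StrictMono h) (hsurj : Surjective h)
    (h0 : h 0 = 0) (h1 : h 1 = 1) (hhalf : h (-(1 / 2)) ≤ h (-1) / 2)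
    (β ξ η A : ℝ) (hβ : β = -h (-1)) (hξ : ξ = 1 - ∫ t in (0 : ℝ)..1, h t)
    (hη : η = 1 + (1 / β) * ∫ t in (-1 : ℝ)..0, h t)
    (hA : A = 4 * ∫ t in (0 : ℝ)..(1 / 4), rhoDist h t (1 - t)) :
    4 * ξ + (2 / 3) * (β / (1 + A)) * η ≥ (2 / 3) * (β / (1 + A)) := by
  have hcont : Continuous h := hmono.monotone.continuous_of_surjective hsurj
  obtain ⟨hξ0, hprod⟩ := one_sub_div_four_le_mul hmono hcont h0 h1
  rw [← hξ, ← hA] at hprod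
  rw [← hξ] at hξ0
  have hJ := average_endpoints_le_integral hmono.monotone
  set J := ∫ t in (-1 : ℝ)..0, h t
  have hneg : h (-(1 / 2)) < 0 := h0 ▸ hmono (by norm_num)
  have hβ0 : 0 < β := by
    rw [hβ]
    linarith [hmono (show (-1 : ℝ) < 0 by norm_num)]
  have hA0 : 0 < 1 + A := by
    by_contra! hle
    linarith [mul_nonpos_of_nonneg_of_nonpos hξ0.le hle]
  have hkey : 0 ≤ (4 * (ξ * (1 + A)) + 2 / 3 * J) / (1 + A) :=
    div_nonneg (by linarith) hA0.le
  have heq : 4 * ξ + (2 / 3) * (β / (1 + A)) * η - (2 / 3) * (β / (1 + A)) =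
      (4 * (ξ * (1 + A)) + 2 / 3 * J) / (1 + A) := by
    rw [hη]
    field_simp
    ring
  linarith
end
end

section
/- Let g(x,y) = 4/(1 + x² + y²)² be the spherical density on the upper half-plane ℍ. There exists a uniform constant C > 0 such that for every nonnegative measurable function f on ℍ, ∫_ℝ ∫₀^∞ (2/y) ( ∫_{−y/4}^{y/4} f(x+z, y−|z|) dz ) g(x,y) dy dx ≤ C ∫_ℝ ∫₀^∞ f(x,y) g(x,y) dy dx. -/
open MeasureTheory Set

noncomputable section

/-- Shearing by `(z, -|z|)` and exchanging the order of integration preserves a triple integral. -/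
lemma lintegral_shear_swap {K : ℝ → ℝ → ℝ → ENNReal}
    (hK : Measurable fun q : ℝ × ℝ × ℝ => K q.1 q.2.1 q.2.2) :
    ∫⁻ x : ℝ, ∫⁻ y : ℝ, ∫⁻ z : ℝ, K z (x + z) (y - |z|) =
      ∫⁻ x : ℝ, ∫⁻ y : ℝ, ∫⁻ z : ℝ, K z x y := by
  have swap {L : ℝ → ℝ → ℝ → ENNReal}
      (hL : Measurable fun q : ℝ × ℝ × ℝ => L q.1 q.2.1 q.2.2) :
      ∫⁻ x : ℝ, ∫⁻ y : ℝ, ∫⁻ z : ℝ, L z x y = ∫⁻ z : ℝ, ∫⁻ x : ℝ, ∫⁻ y : ℝ, L z x y := by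
    have h1 (x : ℝ) : ∫⁻ y : ℝ, ∫⁻ z : ℝ, L z x y = ∫⁻ z : ℝ, ∫⁻ y : ℝ, L z x y := by
      apply lintegral_lintegral_swap
      have : Measurable fun q : ℝ × ℝ => (q.2, x, q.1) := by fun_prop
      exact (hL.comp this).aemeasurable
    simp_rw [h1]
    apply lintegral_lintegral_swap
    apply Measurable.aemeasurable
    have : Measurable fun q : (ℝ × ℝ) × ℝ => (q.1.2, q.1.1, q.2) := by fun_prop
    exact Measurable.lintegral_prod_right' (hL.comp this)
  have hmeas : Measurable fun q : ℝ × ℝ × ℝ => (q.1, q.2.1 + q.1, q.2.2 - |q.1|) := by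
    fun_prop
  rw [swap (L := fun z x y => K z (x + z) (y - |z|)) (hK.comp hmeas), swap hK]
  refine lintegral_congr fun z => ?_
  have h2 (x : ℝ) : ∫⁻ y : ℝ, K z (x + z) (y - |z|) = ∫⁻ y : ℝ, K z (x + z) y :=
    lintegral_sub_right_eq_self (fun y => K z (x + z) y) |z|
  simp_rw [h2]
  exact lintegral_add_right_eq_self (fun x => ∫⁻ y : ℝ, K z x y) z

lemma sphDen_le_four_mul_shear {x y z : ℝ} (hz : |z| < y / 4) :
    sphDen (x, y) ≤ 4 * sphDen (x + z, y - |z|) := by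
  have h0 := abs_nonneg z
  have hsq := sq_abs z
  have key : 1 + (x + z) ^ 2 + (y - |z|) ^ 2 ≤ 2 * (1 + x ^ 2 + y ^ 2) := by
    nlinarith [sq_nonneg (x - z), mul_nonneg h0 (sub_nonneg.2 hz.le)]
  simp only [sphDen]
  rw [mul_div_assoc', div_le_div_iff₀ (by positivity) (by positivity)]
  have : (1 + (x + z) ^ 2 + (y - |z|) ^ 2) ^ 2 ≤ (2 * (1 + x ^ 2 + y ^ 2)) ^ 2 := by
    gcongr
  nlinarith

@[fun_prop]
lemma measurable_sphDen : Measurable sphDen := by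
  unfold sphDen
  fun_prop

/-- There is a uniform `C > 0` such that for every nonnegative measurable
function `f` on the upper half-plane,
`∫_ℝ ∫₀^∞ (2/y)(∫_{−y/4}^{y/4} f(x+z, y−|z|) dz) g(x,y) dy dx
  ≤ C ∫_ℝ ∫₀^∞ f(x,y) g(x,y) dy dx`, where `g = sphDen`. -/
theorem averaged_spherical_integral_bound :
    ∃ C : ℝ, 0 < C ∧
      ∀ f : ℝ × ℝ → ENNReal, Measurable f →
        (∫⁻ x : ℝ, ∫⁻ y in Ioi (0 : ℝ),
            ENNReal.ofReal (2 / y) *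
              (∫⁻ z in Ioo (-(y / 4)) (y / 4), f (x + z, y - |z|)) *
              ENNReal.ofReal (sphDen (x, y)))
          ≤ ENNReal.ofReal C *
            ∫⁻ x : ℝ, ∫⁻ y in Ioi (0 : ℝ), f (x, y) * ENNReal.ofReal (sphDen (x, y)) := by
  refine ⟨16 / 3, by norm_num, fun f hf => ?_⟩
  set F : ℝ → ℝ → ENNReal := fun u v =>
    ENNReal.ofReal (2 / v) * f (u, v) * ENNReal.ofReal (4 * sphDen (u, v)) with hF
  set K : ℝ → ℝ → ℝ → ENNReal := fun z u v =>
    {q : ℝ × ℝ | |q.1| < q.2 / 3}.indicator (fun _ => F u v) (z, v) with hK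
  have hFm : Measurable fun p : ℝ × ℝ => F p.1 p.2 := by
    simp only [hF]
    fun_prop
  have hKm : Measurable fun q : ℝ × ℝ × ℝ => K q.1 q.2.1 q.2.2 := by
    have hs : MeasurableSet {q : ℝ × ℝ × ℝ | |q.1| < q.2.2 / 3} :=
      measurableSet_lt (by fun_prop) (by fun_prop)
    exact (hFm.comp measurable_snd).indicator hs
  calc
    _ ≤ ∫⁻ x : ℝ, ∫⁻ y : ℝ, ∫⁻ z : ℝ, K z (x + z) (y - |z|) := by
      refine lintegral_mono fun x => ?_
      refine (setLIntegral_mono' measurableSet_Ioi fun y hy => ?_).trans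
        (setLIntegral_le_lintegral (Ioi 0) _)
      have hm : Measurable fun z : ℝ => f (x + z, y - |z|) := by fun_prop
      rw [← lintegral_const_mul _ hm, ← lintegral_mul_const _ (hm.const_mul _)]
      refine (setLIntegral_mono' measurableSet_Ioo fun z hz => ?_).trans
        (setLIntegral_le_lintegral (Ioo (-(y / 4)) (y / 4)) _)
      have hz' : |z| < y / 4 := abs_lt.2 hz
      have hy' : 0 < y := hy
      have hv : |z| < (y - |z|) / 3 := by linarith
      have h0 := abs_nonneg z
      have hmem : (z, y - |z|) ∈ {q : ℝ × ℝ | |q.1| < q.2 / 3} := hv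
      simp only [hK, indicator_of_mem hmem, hF]
      gcongr
      · linarith
      · linarith
      · exact sphDen_le_four_mul_shear hz'
    _ = ∫⁻ x : ℝ, ∫⁻ y : ℝ, ∫⁻ z : ℝ, K z x y := lintegral_shear_swap hKm
    _ = ∫⁻ x : ℝ, ENNReal.ofReal (16 / 3) *
          ∫⁻ y in Ioi (0 : ℝ), f (x, y) * ENNReal.ofReal (sphDen (x, y)) := by
      refine lintegral_congr fun x => ?_
      rw [← lintegral_const_mul _ (by fun_prop), ← lintegral_indicator measurableSet_Ioi]
      refine lintegral_congr fun y => ?_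
      have h1 : (fun z => K z x y) = (Ioo (-(y / 3)) (y / 3)).indicator fun _ => F x y := by
        ext z
        simp only [hK, indicator, mem_ofPred_eq, mem_Ioo, abs_lt]
      rw [h1, lintegral_indicator_const measurableSet_Ioo, Real.volume_Ioo]
      by_cases hy : y ∈ Ioi (0 : ℝ)
      · rw [indicator_of_mem hy]
        have hy' : 0 < y := hy
        simp only [hF]
        have h4 : ENNReal.ofReal (4 * sphDen (x, y)) =
            ENNReal.ofReal 4 * ENNReal.ofReal (sphDen (x, y)) :=
          ENNReal.ofReal_mul (by norm_num)
        have h5 : ENNReal.ofReal (16 / 3) =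
            ENNReal.ofReal (2 / y) * ENNReal.ofReal 4 * ENNReal.ofReal (y / 3 - -(y / 3)) := by
          rw [← ENNReal.ofReal_mul (by positivity), ← ENNReal.ofReal_mul (by positivity)]
          congr 1
          field_simp
          norm_num
        rw [h4, h5]
        ring
      · rw [indicator_of_notMem hy, ENNReal.ofReal_of_nonpos, mul_zero]
        have : y ≤ 0 := not_lt.1 hy
        linarith
    _ = _ := by
      refine lintegral_const_mul _ ?_
      have : Measurable fun p : ℝ × ℝ => f p * ENNReal.ofReal (sphDen p) := by fun_prop
      exact this.lintegral_prod_right'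
end
end
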